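/- Let V be a finite-dimensional vector space over a field of characteristic zero, N : V → V a nilpotent endomorphism, n ≥ 0 an integer, and W a weight filtration of N centered at n. Let N also denote the induced maps Gr_ℓ → Gr_{ℓ−2} on graded quotients Gr_ℓ = W_ℓ/W_{ℓ−1}, and for k ≥ 0 set P_{n+k} = ker(N^{k+1} : Gr_{n+k} → Gr_{n−k−2}). Then each Gr_{n+k} with k ≥ 0 admits the primitive (Lefschetz) decomposition Gr_{n+k} = ⊕_{j ≥ 0} N^j(P_{n+k+2j}), an internal direct sum of the images of the primitive subspaces under the induced powers of N. -/

import Mathlib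

/-- A weight filtration of a nilpotent endomorphism `N` centered at `n`:
an increasing filtration `W` with `W ℓ = ⊥` for `ℓ < 0`, `W ℓ = ⊤` for `ℓ ≥ 2n`,
`N (W ℓ) ⊆ W (ℓ - 2)`, and such that for every `k ≥ 0` the induced map
`N ^ k : W (n+k) / W (n+k-1) → W (n-k) / W (n-k-1)` is an isomorphism
(expressed by the injectivity and surjectivity of the induced map). -/
def IsWeightFiltration {K V : Type*} [Field K] [AddCommGroup V] [Module K V]
    (N : V →ₗ[K] V) (n : ℕ) (W : ℤ → Submodule K V) : Prop :=
  Monotone W ∧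
  (∀ ℓ : ℤ, ℓ < 0 → W ℓ = ⊥) ∧
  (∀ ℓ : ℤ, 2 * (n : ℤ) ≤ ℓ → W ℓ = ⊤) ∧
  (∀ ℓ : ℤ, ∀ v ∈ W ℓ, N v ∈ W (ℓ - 2)) ∧
  (∀ k : ℕ,
    (∀ v ∈ W ((n : ℤ) + k), (N ^ k) v ∈ W ((n : ℤ) - k - 1) → v ∈ W ((n : ℤ) + k - 1)) ∧
    (∀ w ∈ W ((n : ℤ) - k), ∃ v ∈ W ((n : ℤ) + k), (N ^ k) v - w ∈ W ((n : ℤ) - k - 1)))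


theorem wf_pow {K V : Type*} [Field K] [AddCommGroup V] [Module K V]
    {N : V →ₗ[K] V} {W : ℤ → Submodule K V}
    (h : ∀ ℓ : ℤ, ∀ v ∈ W ℓ, N v ∈ W (ℓ - 2)) (j : ℕ) (ℓ ℓ' : ℤ) (e : ℓ' = ℓ - 2 * j)
    (v : V) (hv : v ∈ W ℓ) : (N ^ j) v ∈ W ℓ' := by
  subst e
  induction j with
  | zero => simpa using hv
  | succ j ih =>
    rw [pow_succ', Module.End.mul_apply]
    have := h _ _ ih
    convert this using 2
    push_cast; ring

theorem wf_pow_succ {K V : Type*} [Field K] [AddCommGroup V] [Module K V]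
    (N : V →ₗ[K] V) (j : ℕ) (v : V) : (N ^ j) (N v) = (N ^ (j + 1)) v := by
  rw [pow_succ, Module.End.mul_apply]

theorem wf_succ_pow {K V : Type*} [Field K] [AddCommGroup V] [Module K V]
    (N : V →ₗ[K] V) (j : ℕ) (v : V) : N ((N ^ j) v) = (N ^ (j + 1)) v := by
  rw [pow_succ', Module.End.mul_apply]

theorem wf_cast {K V : Type*} [Field K] [AddCommGroup V] [Module K V]
    {W : ℤ → Submodule K V} {a b : ℤ} {v : V} (h : v ∈ W a) (e : a = b) : v ∈ W b := e ▸ h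

/-- Primitive (Lefschetz) decomposition `Gr (n+k) = ⊕_{j ≥ 0} N^j (P (n+k+2j))`.
An element `c ∈ W (n+k+2j)` represents a class of the primitive subspace
`P (n+k+2j) = ker (N^(k+2j+1) : Gr (n+k+2j) → Gr (n-k-2j-2))` exactly when
`N^(k+2j+1) c ∈ W (n-k-2j-3)`.  Spanning: every class of `Gr (n+k)` is a finite sum of
classes `N^j (c j)` with `c j` primitive.  Independence: if such a finite sum vanishes in
`Gr (n+k)`, each summand vanishes in `Gr (n+k)`. -/
theorem weight_filtration_lefschetz_decomposition {K V : Type*} [Field K] [CharZero K]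
    [AddCommGroup V] [Module K V] [FiniteDimensional K V]
    (N : V →ₗ[K] V) (hN : IsNilpotent N) (n : ℕ)
    (W : ℤ → Submodule K V) (hW : IsWeightFiltration N n W) :
    ∀ k : ℕ,
      (∀ w ∈ W ((n : ℤ) + k), ∃ (m : ℕ) (c : ℕ → V),
        (∀ j : ℕ, c j ∈ W ((n : ℤ) + k + 2 * j) ∧
          (N ^ (k + 2 * j + 1)) (c j) ∈ W ((n : ℤ) - k - 2 * j - 3)) ∧
        w - (∑ j ∈ Finset.range m, (N ^ j) (c j)) ∈ W ((n : ℤ) + k - 1)) ∧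
      (∀ (m : ℕ) (c : ℕ → V),
        (∀ j : ℕ, c j ∈ W ((n : ℤ) + k + 2 * j) ∧
          (N ^ (k + 2 * j + 1)) (c j) ∈ W ((n : ℤ) - k - 2 * j - 3)) →
        (∑ j ∈ Finset.range m, (N ^ j) (c j)) ∈ W ((n : ℤ) + k - 1) →
        ∀ j < m, (N ^ j) (c j) ∈ W ((n : ℤ) + k - 1)) := by
  obtain ⟨-, -, htop, hNW, hiso⟩ := hW
  intro k
  constructor
  · suffices H : ∀ d k : ℕ, n < k + d → ∀ w ∈ W ((n : ℤ) + k), ∃ (m : ℕ) (c : ℕ → V),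
        (∀ j : ℕ, c j ∈ W ((n : ℤ) + k + 2 * j) ∧
          (N ^ (k + 2 * j + 1)) (c j) ∈ W ((n : ℤ) - k - 2 * j - 3)) ∧
        w - (∑ j ∈ Finset.range m, (N ^ j) (c j)) ∈ W ((n : ℤ) + k - 1) from
      H (n + 1) k (by omega)
    intro d
    induction d with
    | zero =>
      intro k hk w hw
      refine ⟨0, 0, fun j => by simp, ?_⟩
      rw [htop _ (by omega)]
      trivial
    | succ d ih =>
      intro k hk w hw
      have h1 : (N ^ (k + 1)) w ∈ W ((n : ℤ) - (k + 2 : ℕ)) :=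
        wf_pow hNW (k + 1) _ _ (by push_cast; ring) w hw
      obtain ⟨v, hv, hvw⟩ := (hiso (k + 2)).2 _ h1
      obtain ⟨m, c, hc, hm⟩ := ih (k + 2) (by omega) v hv
      have hNv : N v ∈ W ((n : ℤ) + k) := wf_cast (hNW _ _ hv) (by push_cast; ring)
      refine ⟨m + 1, fun j => Nat.casesOn j (w - N v) c, ?_, ?_⟩
      · intro j
        cases j with
        | zero =>
          refine ⟨wf_cast (Submodule.sub_mem _ hw hNv) (by push_cast; ring), ?_⟩
          have := Submodule.neg_mem _ hvw
          refine wf_cast (a := (n : ℤ) - (k + 2 : ℕ) - 1) ?_ (by push_cast; ring)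
          simpa [wf_pow_succ] using this
        | succ j =>
          obtain ⟨a, b⟩ := hc j
          refine ⟨wf_cast a (by push_cast; ring), ?_⟩
          have e : k + 2 * (j + 1) + 1 = k + 2 + 2 * j + 1 := by ring
          rw [e]
          exact wf_cast b (by push_cast; ring)
      · rw [Finset.sum_range_succ']
        have h2 := hNW _ _ hm
        refine wf_cast (a := (n : ℤ) + (k + 2 : ℕ) - 1 - 2) ?_ (by push_cast; ring)
        rw [map_sub, map_sum] at h2
        simp only [wf_succ_pow] at h2
        convert h2 using 1
        simp only [pow_zero, Module.End.one_apply]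
        change w - (∑ x ∈ Finset.range m, (N ^ (x + 1)) (c x) + (w - N v)) = _
        generalize (∑ x ∈ Finset.range m, (N ^ (x + 1)) (c x)) = S
        abel
  · intro m
    induction m generalizing k with
    | zero => intro c _ _ j hj; omega
    | succ m ih =>
      intro c hc hs
      rw [Finset.sum_range_succ'] at hs
      simp only [← wf_succ_pow, ← map_sum, pow_zero, Module.End.one_apply] at hs
      have hc' : ∀ j : ℕ, c (j + 1) ∈ W ((n : ℤ) + (k + 2 : ℕ) + 2 * j) ∧
          (N ^ (k + 2 + 2 * j + 1)) (c (j + 1)) ∈ W ((n : ℤ) - (k + 2 : ℕ) - 2 * j - 3) := by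
        intro j
        obtain ⟨a, b⟩ := hc (j + 1)
        refine ⟨wf_cast a (by push_cast; ring), ?_⟩
        have e : k + 2 * (j + 1) + 1 = k + 2 + 2 * j + 1 := by ring
        rw [e] at b
        exact wf_cast b (by push_cast; ring)
      have hu : (∑ j ∈ Finset.range m, (N ^ j) (c (j + 1))) ∈ W ((n : ℤ) + (k + 2 : ℕ)) :=
        Submodule.sum_mem _ fun j _ => wf_pow hNW j _ _ (by ring) _ (hc' j).1
      set u := ∑ j ∈ Finset.range m, (N ^ j) (c (j + 1)) with hudef
      have h1 : (N ^ (k + 1)) (N u + c 0) ∈ W ((n : ℤ) - (k + 2 : ℕ) - 1) :=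
        wf_pow hNW (k + 1) _ _ (by push_cast; ring) _ hs
      have h0 : (N ^ (k + 1)) (c 0) ∈ W ((n : ℤ) - (k + 2 : ℕ) - 1) :=
        wf_cast (hc 0).2 (by push_cast; ring)
      have h2 := Submodule.sub_mem _ h1 h0
      rw [map_add, add_sub_cancel_right, wf_pow_succ] at h2
      have h3 := (hiso (k + 2)).1 u hu h2
      have h4 := ih (k + 2) (fun j => c (j + 1)) hc' h3
      intro j hj
      cases j with
      | zero =>
        have h5 : N u ∈ W ((n : ℤ) + k - 1) := wf_cast (hNW _ _ h3) (by push_cast; ring)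
        simpa using Submodule.sub_mem _ hs h5
      | succ j =>
        rw [← wf_succ_pow]
        exact wf_cast (hNW _ _ (h4 j (by omega))) (by push_cast; ring)
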